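/- arXiv:math/0701024 — 2 statements merged into one kernel-verified Lean document; each statement's English description precedes it below -/
import Mathlib

section
/- Let (M, U, V, s, t, e, m, i) be a local groupoid in sets. Then the nerve NG is a well-defined simplicial set: for every n, the face maps d₀(g₁,…,gₙ) = (g₂,…,gₙ), dₙ(g₁,…,gₙ) = (g₁,…,g_{n−1}), and d_k(g₁,…,gₙ) = (g₁,…,g_{k−1}, m(g_k, g_{k+1}), g_{k+2},…,gₙ) for 0 < k < n map NG_n into NG_{n−1}; the degeneracy maps inserting unit elements map NG_n into NG_{n+1}; and these maps satisfy all the simplicial identities. -/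
/-- A local groupoid in sets: sets `M` (objects) and `U` (arrows), a subset `V ⊆ U` on which
all structure maps are defined, source and target maps `s, t : U → M`, a unit map `e : M → U`,
a multiplication `mul` defined (i.e. subject to axioms) whenever both factors lie in `V` and
are composable, restricted associativity, and an inversion `inv` defined on `V`. -/
structure LocalGroupoid : Type (max (u_1 + 1) (u_2 + 1)) where
  M : Type u_1
  U : Type u_2
  V : Set U
  s : U → M
  t : U → M
  e : M → U
  mul : U → U → U
  inv : U → U
  e_mem : ∀ x, e x ∈ V
  s_e : ∀ x, s (e x) = x
  t_e : ∀ x, t (e x) = x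
  s_mul : ∀ g h, g ∈ V → h ∈ V → s g = t h → s (mul g h) = s h
  t_mul : ∀ g h, g ∈ V → h ∈ V → s g = t h → t (mul g h) = t g
  one_mul : ∀ g ∈ V, mul (e (t g)) g = g
  mul_one : ∀ g ∈ V, mul g (e (s g)) = g
  mul_assoc : ∀ g h k, g ∈ V → h ∈ V → k ∈ V → s g = t h → s h = t k →
    mul g h ∈ V → mul h k ∈ V → mul (mul g h) k = mul g (mul h k)
  inv_mem : ∀ g ∈ V, inv g ∈ V
  s_inv : ∀ g ∈ V, s (inv g) = t g
  t_inv : ∀ g ∈ V, t (inv g) = s g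
  inv_mul : ∀ g ∈ V, mul (inv g) g = e (s g)
  mul_inv : ∀ g ∈ V, mul g (inv g) = e (t g)

namespace LocalGroupoid

variable (G : LocalGroupoid)

/-- The partial products `p(i, i+k) = g_i ⋅ g_{i+1} ⋯ g_{i+k}` of a string of arrows. -/
def chain (G : LocalGroupoid) {n : ℕ} (g : Fin n → G.U) : (i k : ℕ) → i + k < n → G.U
  | i, 0, _ => g ⟨i, by omega⟩
  | i, k + 1, _ => G.mul (chain G g i k (by omega)) (g ⟨i + k + 1, by omega⟩)

/-- An `n`-simplex of the nerve `NG` of a local groupoid: a string of vertices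
`x : Fin (n+1) → M` and arrows `g : Fin n → U` such that every arrow lies in `V`, the arrows
are composable along the vertices (`t (g l) = x l` and `s (g l) = x (l+1)`), and all partial
products `p(i,j)` are defined and lie in `V`. -/
def IsNerve {n : ℕ} (x : Fin (n + 1) → G.M) (g : Fin n → G.U) : Prop :=
  (∀ l, g l ∈ G.V) ∧
  (∀ l : Fin n, G.t (g l) = x l.castSucc ∧ G.s (g l) = x l.succ) ∧
  (∀ (i k : ℕ) (h : i + k < n), G.chain g i k h ∈ G.V)

/-- The `j`-th face map on vertices: delete the vertex `j`. -/
def faceVert {α : Type*} {n : ℕ} (j : Fin (n + 2)) (x : Fin (n + 2) → α) :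
    Fin (n + 1) → α :=
  x ∘ j.succAbove

/-- The `j`-th face map on arrows: for `j = 0` drop the first arrow, for `j = n+1` drop the
last arrow, and for `0 < j < n+1` multiply the two arrows adjacent to the vertex `j`. -/
def faceArr {n : ℕ} (j : Fin (n + 2)) (g : Fin (n + 1) → G.U) : Fin n → G.U := fun l =>
  if (l : ℕ) + 1 < (j : ℕ) then g l.castSucc
  else if (l : ℕ) + 1 = (j : ℕ) then G.mul (g l.castSucc) (g l.succ)
  else g l.succ

/-- The `j`-th degeneracy map on vertices: repeat the vertex `j`. -/
def degVert {α : Type*} {n : ℕ} (j : Fin (n + 1)) (x : Fin (n + 1) → α) :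
    Fin (n + 2) → α :=
  x ∘ j.predAbove

/-- The `j`-th degeneracy map on arrows: insert the unit element `e (x j)` at position `j`. -/
def degArr {n : ℕ} (j : Fin (n + 1)) (x : Fin (n + 1) → G.M) (g : Fin n → G.U) :
    Fin (n + 1) → G.U := fun l =>
  if h1 : (l : ℕ) < (j : ℕ) then g ⟨l, by have := j.isLt; omega⟩
  else if h2 : (l : ℕ) = (j : ℕ) then G.e (x j)
  else g ⟨(l : ℕ) - 1, by have := l.isLt; omega⟩

/-- A compatible family of arrows `a i j` for `i ≤ j` over the vertices `x`: the arrow `a i j`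
goes from `x j` to `x i`, lies in `V`, is a unit for `i = j`, and `a i j ⋅ a j k = a i k`. -/
structure IsCompatible {n : ℕ} (x : Fin (n + 1) → G.M) (a : Fin (n + 1) → Fin (n + 1) → G.U) :
    Prop where
  mem : ∀ i j, i ≤ j → a i j ∈ G.V
  target : ∀ i j, i ≤ j → G.t (a i j) = x i
  source : ∀ i j, i ≤ j → G.s (a i j) = x j
  self : ∀ i, a i i = G.e (x i)
  mul : ∀ i j k, i ≤ j → j ≤ k → G.mul (a i j) (a j k) = a i k

/-- The consecutive entries `a l (l+1)` of a family of arrows. -/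
def spine {α : Type*} {n : ℕ} (a : Fin (n + 1) → Fin (n + 1) → α) : Fin n → α :=
  fun l => a l.castSucc l.succ

/-- Reindexing of a family of arrows along a map of vertices. -/
def pullback {α : Type*} {n m : ℕ} (φ : Fin (m + 1) → Fin (n + 1))
    (a : Fin (n + 1) → Fin (n + 1) → α) : Fin (m + 1) → Fin (m + 1) → α :=
  fun i j => a (φ i) (φ j)

variable {G}

theorem IsCompatible.pullback {n m : ℕ} {x : Fin (n + 1) → G.M}
    {a : Fin (n + 1) → Fin (n + 1) → G.U} (ha : G.IsCompatible x a)
    {φ : Fin (m + 1) → Fin (n + 1)} (hφ : Monotone φ) :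
    G.IsCompatible (x ∘ φ) (pullback φ a) where
  mem _ _ h := ha.mem _ _ (hφ h)
  target _ _ h := ha.target _ _ (hφ h)
  source _ _ h := ha.source _ _ (hφ h)
  self _ := ha.self _
  mul _ _ _ h h' := ha.mul _ _ _ (hφ h) (hφ h')

theorem IsCompatible.chain_spine {n : ℕ} {x : Fin (n + 1) → G.M}
    {a : Fin (n + 1) → Fin (n + 1) → G.U} (ha : G.IsCompatible x a) (i k : ℕ) (h : i + k < n) :
    G.chain (spine a) i k h = a ⟨i, by omega⟩ ⟨i + k + 1, by omega⟩ := by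
  induction k with
  | zero => rfl
  | succ k ih =>
    rw [chain, ih (by omega)]
    exact ha.mul _ _ _ (Fin.mk_le_mk.2 (by omega)) (Fin.mk_le_mk.2 (by omega))

theorem IsCompatible.isNerve {n : ℕ} {x : Fin (n + 1) → G.M}
    {a : Fin (n + 1) → Fin (n + 1) → G.U} (ha : G.IsCompatible x a) :
    G.IsNerve x (spine a) := by
  refine ⟨fun l => ha.mem _ _ l.castSucc_lt_succ.le, fun l =>
    ⟨ha.target _ _ l.castSucc_lt_succ.le, ha.source _ _ l.castSucc_lt_succ.le⟩, fun i k h => ?_⟩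
  rw [ha.chain_spine]
  exact ha.mem _ _ (Fin.mk_le_mk.2 (by omega))

theorem IsNerve.target_source_chain {n : ℕ} {x : Fin (n + 1) → G.M} {g : Fin n → G.U}
    (hg : G.IsNerve x g) (i k : ℕ) (h : i + k < n) :
    G.t (G.chain g i k h) = x ⟨i, by omega⟩ ∧
      G.s (G.chain g i k h) = x ⟨i + k + 1, by omega⟩ := by
  obtain ⟨hV, hc, hp⟩ := hg
  induction k with
  | zero => exact hc ⟨i, h⟩
  | succ k ih =>
    obtain ⟨ht, hs⟩ := ih (by omega)
    have hst : G.s (G.chain g i k (by omega)) = G.t (g ⟨i + k + 1, by omega⟩) :=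
      hs.trans (hc ⟨i + k + 1, by omega⟩).1.symm
    rw [chain, G.t_mul _ _ (hp _ _ _) (hV _) hst, G.s_mul _ _ (hp _ _ _) (hV _) hst]
    exact ⟨ht, (hc ⟨i + k + 1, by omega⟩).2⟩

theorem IsNerve.chain_mul_chain {n : ℕ} {x : Fin (n + 1) → G.M} {g : Fin n → G.U}
    (hg : G.IsNerve x g) (i k l : ℕ) (h : i + k + 1 + l < n) :
    G.mul (G.chain g i k (by omega)) (G.chain g (i + k + 1) l h) =
      G.chain g i (k + 1 + l) (by omega) := by
  induction l with
  | zero => rfl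
  | succ l ih =>
    have ih := ih (by omega)
    have hst := (hg.target_source_chain i k (by omega)).2.trans
      (hg.target_source_chain (i + k + 1) l (by omega)).1.symm
    have hst' := (hg.target_source_chain (i + k + 1) l (by omega)).2.trans
      (hg.2.1 ⟨i + k + 1 + l + 1, by omega⟩).1.symm
    have key := G.mul_assoc _ _ _ (hg.2.2 i k (by omega)) (hg.2.2 (i + k + 1) l (by omega))
      (hg.1 ⟨i + k + 1 + l + 1, by omega⟩) hst hst' (ih ▸ hg.2.2 _ _ _)
      (hg.2.2 (i + k + 1) (l + 1) h)
    rw [ih] at key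
    refine key.symm.trans ?_
    change _ = G.mul (G.chain g i (k + 1 + l) _) (g ⟨i + (k + 1 + l) + 1, _⟩)
    congr 3
    omega

theorem IsNerve.exists_isCompatible {n : ℕ} {x : Fin (n + 1) → G.M} {g : Fin n → G.U}
    (hg : G.IsNerve x g) : ∃ a, G.IsCompatible x a ∧ spine a = g := by
  let a : Fin (n + 1) → Fin (n + 1) → G.U := fun i j =>
    if h : i < j then G.chain g i (j - i - 1) (by omega) else G.e (x i)
  have ha_self : ∀ i, a i i = G.e (x i) := fun i => dif_neg (lt_irrefl i)
  have ha_add : ∀ (i k : ℕ) (h : i + k < n),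
      a ⟨i, by omega⟩ ⟨i + k + 1, by omega⟩ = G.chain g i k h := by
    intro i k h
    have hlt : (⟨i, by omega⟩ : Fin (n + 1)) < ⟨i + k + 1, by omega⟩ :=
      Fin.mk_lt_mk.2 (by omega)
    simp only [a, dif_pos hlt]
    congr 1
    omega
  have exists_add : ∀ i j : Fin (n + 1), i < j → ∃ (p k : ℕ) (h : p + k < n),
      i = ⟨p, by omega⟩ ∧ j = ⟨p + k + 1, by omega⟩ := by
    intro i j h
    refine ⟨i, j - i - 1, by omega, rfl, Fin.ext ?_⟩
    simp only
    omega
  have ha : ∀ i j, i ≤ j → a i j ∈ G.V ∧ G.t (a i j) = x i ∧ G.s (a i j) = x j := by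
    intro i j h
    rcases h.eq_or_lt with rfl | hlt
    · rw [ha_self]
      exact ⟨G.e_mem _, G.t_e _, G.s_e _⟩
    · obtain ⟨p, k, hpk, rfl, rfl⟩ := exists_add i j hlt
      rw [ha_add p k hpk]
      exact ⟨hg.2.2 _ _ _, hg.target_source_chain _ _ _⟩
  refine ⟨a, ⟨fun i j h => (ha i j h).1, fun i j h => (ha i j h).2.1,
    fun i j h => (ha i j h).2.2, ha_self, fun i j k hij hjk => ?_⟩, ?_⟩
  · rcases hij.eq_or_lt with rfl | hij'
    · rw [ha_self, ← (ha i k hjk).2.1, G.one_mul _ (ha i k hjk).1]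
    rcases hjk.eq_or_lt with rfl | hjk'
    · rw [ha_self, ← (ha i j hij).2.2, G.mul_one _ (ha i j hij).1]
    obtain ⟨p, q, h, rfl, rfl⟩ := exists_add i j hij'
    obtain ⟨r, q', h', hr, rfl⟩ := exists_add _ k hjk'
    obtain rfl : p + q + 1 = r := congrArg Fin.val hr
    rw [ha_add p q h, ha_add _ q' h', hg.chain_mul_chain, ← ha_add]
    congr 2
    omega
  · funext l
    exact ha_add l 0 l.isLt

theorem val_succAbove {n : ℕ} (j : Fin (n + 1)) (i : Fin n) :
    (j.succAbove i : ℕ) = if (i : ℕ) < j then (i : ℕ) else i + 1 := by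
  simp only [Fin.succAbove, Fin.lt_def, Fin.val_castSucc]
  split_ifs <;> simp

theorem val_predAbove {n : ℕ} (j : Fin n) (i : Fin (n + 1)) :
    (j.predAbove i : ℕ) = if (j : ℕ) < i then (i : ℕ) - 1 else i := by
  simp only [Fin.predAbove, Fin.lt_def, Fin.val_castSucc]
  split_ifs <;> simp

theorem IsCompatible.faceArr_spine {n : ℕ} {x : Fin (n + 2) → G.M}
    {a : Fin (n + 2) → Fin (n + 2) → G.U} (ha : G.IsCompatible x a) (j : Fin (n + 2)) :
    G.faceArr j (spine a) = spine (LocalGroupoid.pullback j.succAbove a) := by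
  funext l
  unfold faceArr spine LocalGroupoid.pullback
  split_ifs with h1 h2
  · congr 1 <;> ext <;> simp [val_succAbove] <;> omega
  · have h := ha.mul l.castSucc.castSucc l.succ.castSucc l.succ.succ
      (by simp [Fin.le_def]) (by simp [Fin.le_def])
    refine h.trans ?_
    congr 1 <;> ext <;> simp [val_succAbove] <;> omega
  · congr 1 <;> ext <;> simp [val_succAbove] <;> omega

theorem IsCompatible.degArr_spine {n : ℕ} {x : Fin (n + 1) → G.M}
    {a : Fin (n + 1) → Fin (n + 1) → G.U} (ha : G.IsCompatible x a) (j : Fin (n + 1)) :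
    G.degArr j x (spine a) = spine (LocalGroupoid.pullback j.predAbove a) := by
  funext l
  unfold degArr spine LocalGroupoid.pullback
  split_ifs with h1 h2
  · congr 1 <;> ext <;> simp only [val_predAbove, Fin.val_castSucc, Fin.val_succ] <;> grind
  · rw [← ha.self]
    congr 1 <;> ext <;> simp only [val_predAbove, Fin.val_castSucc, Fin.val_succ] <;> grind
  · congr 1 <;> ext <;> simp only [val_predAbove, Fin.val_castSucc, Fin.val_succ] <;> grind

theorem IsCompatible.face {n : ℕ} {x : Fin (n + 2) → G.M}
    {a : Fin (n + 2) → Fin (n + 2) → G.U} (ha : G.IsCompatible x a) (j : Fin (n + 2)) :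
    G.IsCompatible (faceVert j x) (LocalGroupoid.pullback j.succAbove a) :=
  ha.pullback (Fin.strictMono_succAbove j).monotone

theorem IsCompatible.deg {n : ℕ} {x : Fin (n + 1) → G.M}
    {a : Fin (n + 1) → Fin (n + 1) → G.U} (ha : G.IsCompatible x a) (j : Fin (n + 1)) :
    G.IsCompatible (degVert j x) (LocalGroupoid.pullback j.predAbove a) :=
  ha.pullback (Fin.predAbove_right_monotone j)

theorem pullback_pullback {α : Type*} {n m p : ℕ} (φ : Fin (m + 1) → Fin (n + 1))
    (ψ : Fin (p + 1) → Fin (m + 1)) (a : Fin (n + 1) → Fin (n + 1) → α) :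
    pullback ψ (pullback φ a) = pullback (φ ∘ ψ) a := rfl

/-- The nerve of a local groupoid is a well-defined simplicial set: the face maps map
`NG_{n+1}` into `NG_n`, the degeneracy maps map `NG_n` into `NG_{n+1}`, and the face and
degeneracy maps satisfy all the simplicial identities (on nerve simplices). -/
theorem nerve_isSimplicialSet (G : LocalGroupoid) :
    -- face maps are well defined
    (∀ (n : ℕ) (j : Fin (n + 2)) (x : Fin (n + 2) → G.M) (g : Fin (n + 1) → G.U),
      G.IsNerve x g → G.IsNerve (faceVert j x) (G.faceArr j g)) ∧
    -- degeneracy maps are well defined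
    (∀ (n : ℕ) (j : Fin (n + 1)) (x : Fin (n + 1) → G.M) (g : Fin n → G.U),
      G.IsNerve x g → G.IsNerve (degVert j x) (G.degArr j x g)) ∧
    -- simplicial identity dᵢ ∘ dⱼ = d_{j-1} ∘ dᵢ for i < j
    (∀ (n i j : ℕ) (hij : i < j) (hj : j ≤ n + 2)
      (x : Fin (n + 3) → G.M) (g : Fin (n + 2) → G.U), G.IsNerve x g →
      faceVert (⟨i, by omega⟩ : Fin (n + 2)) (faceVert (⟨j, by omega⟩ : Fin (n + 3)) x) =
        faceVert (⟨j - 1, by omega⟩ : Fin (n + 2)) (faceVert (⟨i, by omega⟩ : Fin (n + 3)) x) ∧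
      G.faceArr (⟨i, by omega⟩ : Fin (n + 2)) (G.faceArr (⟨j, by omega⟩ : Fin (n + 3)) g) =
        G.faceArr (⟨j - 1, by omega⟩ : Fin (n + 2))
          (G.faceArr (⟨i, by omega⟩ : Fin (n + 3)) g)) ∧
    -- simplicial identity sᵢ ∘ sⱼ = s_{j+1} ∘ sᵢ for i ≤ j
    (∀ (n i j : ℕ) (hij : i ≤ j) (hj : j ≤ n)
      (x : Fin (n + 1) → G.M) (g : Fin n → G.U), G.IsNerve x g →
      degVert (⟨i, by omega⟩ : Fin (n + 2)) (degVert (⟨j, by omega⟩ : Fin (n + 1)) x) =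
        degVert (⟨j + 1, by omega⟩ : Fin (n + 2)) (degVert (⟨i, by omega⟩ : Fin (n + 1)) x) ∧
      G.degArr (⟨i, by omega⟩ : Fin (n + 2)) (degVert (⟨j, by omega⟩ : Fin (n + 1)) x)
          (G.degArr (⟨j, by omega⟩ : Fin (n + 1)) x g) =
        G.degArr (⟨j + 1, by omega⟩ : Fin (n + 2)) (degVert (⟨i, by omega⟩ : Fin (n + 1)) x)
          (G.degArr (⟨i, by omega⟩ : Fin (n + 1)) x g)) ∧
    -- simplicial identity dᵢ ∘ sⱼ = s_{j-1} ∘ dᵢ for i < j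
    (∀ (n i j : ℕ) (hij : i < j) (hj : j ≤ n + 1)
      (x : Fin (n + 2) → G.M) (g : Fin (n + 1) → G.U), G.IsNerve x g →
      faceVert (⟨i, by omega⟩ : Fin (n + 3)) (degVert (⟨j, by omega⟩ : Fin (n + 2)) x) =
        degVert (⟨j - 1, by omega⟩ : Fin (n + 1)) (faceVert (⟨i, by omega⟩ : Fin (n + 2)) x) ∧
      G.faceArr (⟨i, by omega⟩ : Fin (n + 3))
          (G.degArr (⟨j, by omega⟩ : Fin (n + 2)) x g) =
        G.degArr (⟨j - 1, by omega⟩ : Fin (n + 1))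
          (faceVert (⟨i, by omega⟩ : Fin (n + 2)) x)
          (G.faceArr (⟨i, by omega⟩ : Fin (n + 2)) g)) ∧
    -- simplicial identities dⱼ ∘ sⱼ = id and d_{j+1} ∘ sⱼ = id
    (∀ (n j : ℕ) (hj : j ≤ n)
      (x : Fin (n + 1) → G.M) (g : Fin n → G.U), G.IsNerve x g →
      faceVert (⟨j, by omega⟩ : Fin (n + 2)) (degVert (⟨j, by omega⟩ : Fin (n + 1)) x) = x ∧
      G.faceArr (⟨j, by omega⟩ : Fin (n + 2))
        (G.degArr (⟨j, by omega⟩ : Fin (n + 1)) x g) = g ∧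
      faceVert (⟨j + 1, by omega⟩ : Fin (n + 2))
        (degVert (⟨j, by omega⟩ : Fin (n + 1)) x) = x ∧
      G.faceArr (⟨j + 1, by omega⟩ : Fin (n + 2))
        (G.degArr (⟨j, by omega⟩ : Fin (n + 1)) x g) = g) ∧
    -- simplicial identity dᵢ ∘ sⱼ = sⱼ ∘ d_{i-1} for i > j + 1
    (∀ (n i j : ℕ) (hij : j + 1 < i) (hi : i ≤ n + 2)
      (x : Fin (n + 2) → G.M) (g : Fin (n + 1) → G.U), G.IsNerve x g →
      faceVert (⟨i, by omega⟩ : Fin (n + 3)) (degVert (⟨j, by omega⟩ : Fin (n + 2)) x) =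
        degVert (⟨j, by omega⟩ : Fin (n + 1)) (faceVert (⟨i - 1, by omega⟩ : Fin (n + 2)) x) ∧
      G.faceArr (⟨i, by omega⟩ : Fin (n + 3))
          (G.degArr (⟨j, by omega⟩ : Fin (n + 2)) x g) =
        G.degArr (⟨j, by omega⟩ : Fin (n + 1))
          (faceVert (⟨i - 1, by omega⟩ : Fin (n + 2)) x)
          (G.faceArr (⟨i - 1, by omega⟩ : Fin (n + 2)) g)) := by
  refine ⟨?_, ?_, ?_, ?_, ?_, ?_, ?_⟩
  · intro n j x g hg
    obtain ⟨a, ha, rfl⟩ := hg.exists_isCompatible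
    rw [ha.faceArr_spine]
    exact (ha.face j).isNerve
  · intro n j x g hg
    obtain ⟨a, ha, rfl⟩ := hg.exists_isCompatible
    rw [ha.degArr_spine]
    exact (ha.deg j).isNerve
  · intro n i j hij hj x g hg
    obtain ⟨a, ha, rfl⟩ := hg.exists_isCompatible
    have key : (⟨j, by omega⟩ : Fin (n + 3)).succAbove ∘ (⟨i, by omega⟩ : Fin (n + 2)).succAbove =
        (⟨i, by omega⟩ : Fin (n + 3)).succAbove ∘
          (⟨j - 1, by omega⟩ : Fin (n + 2)).succAbove := by
      funext l
      ext
      simp only [Function.comp_apply, val_succAbove]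
      grind
    refine ⟨congrArg (x ∘ ·) key, ?_⟩
    rw [ha.faceArr_spine, ha.faceArr_spine, (ha.face _).faceArr_spine,
      (ha.face _).faceArr_spine, pullback_pullback, pullback_pullback, key]
  · intro n i j hij hj x g hg
    obtain ⟨a, ha, rfl⟩ := hg.exists_isCompatible
    have key : (⟨j, by omega⟩ : Fin (n + 1)).predAbove ∘ (⟨i, by omega⟩ : Fin (n + 2)).predAbove =
        (⟨i, by omega⟩ : Fin (n + 1)).predAbove ∘
          (⟨j + 1, by omega⟩ : Fin (n + 2)).predAbove := by
      funext l
      ext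
      simp only [Function.comp_apply, val_predAbove]
      grind
    refine ⟨congrArg (x ∘ ·) key, ?_⟩
    rw [ha.degArr_spine, ha.degArr_spine, (ha.deg _).degArr_spine,
      (ha.deg _).degArr_spine, pullback_pullback, pullback_pullback, key]
  · intro n i j hij hj x g hg
    obtain ⟨a, ha, rfl⟩ := hg.exists_isCompatible
    have key : (⟨j, by omega⟩ : Fin (n + 2)).predAbove ∘ (⟨i, by omega⟩ : Fin (n + 3)).succAbove =
        (⟨i, by omega⟩ : Fin (n + 2)).succAbove ∘
          (⟨j - 1, by omega⟩ : Fin (n + 1)).predAbove := by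
      funext l
      ext
      simp only [Function.comp_apply, val_predAbove, val_succAbove]
      grind
    refine ⟨congrArg (x ∘ ·) key, ?_⟩
    rw [ha.degArr_spine, ha.faceArr_spine, (ha.deg _).faceArr_spine,
      (ha.face _).degArr_spine, pullback_pullback, pullback_pullback, key]
  · intro n j hj x g hg
    obtain ⟨a, ha, rfl⟩ := hg.exists_isCompatible
    have key : (⟨j, by omega⟩ : Fin (n + 1)).predAbove ∘
        (⟨j, by omega⟩ : Fin (n + 2)).succAbove = id := by
      funext l
      ext
      simp only [Function.comp_apply, val_predAbove, val_succAbove, id]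
      grind
    have key' : (⟨j, by omega⟩ : Fin (n + 1)).predAbove ∘
        (⟨j + 1, by omega⟩ : Fin (n + 2)).succAbove = id := by
      funext l
      ext
      simp only [Function.comp_apply, val_predAbove, val_succAbove, id]
      grind
    refine ⟨congrArg (x ∘ ·) key, ?_, congrArg (x ∘ ·) key', ?_⟩
    · rw [ha.degArr_spine, (ha.deg _).faceArr_spine, pullback_pullback, key]
      rfl
    · rw [ha.degArr_spine, (ha.deg _).faceArr_spine, pullback_pullback, key']
      rfl
  · intro n i j hij hi x g hg
    obtain ⟨a, ha, rfl⟩ := hg.exists_isCompatible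
    have key : (⟨j, by omega⟩ : Fin (n + 2)).predAbove ∘ (⟨i, by omega⟩ : Fin (n + 3)).succAbove =
        (⟨i - 1, by omega⟩ : Fin (n + 2)).succAbove ∘
          (⟨j, by omega⟩ : Fin (n + 1)).predAbove := by
      funext l
      ext
      simp only [Function.comp_apply, val_predAbove, val_succAbove]
      grind
    refine ⟨congrArg (x ∘ ·) key, ?_⟩
    rw [ha.degArr_spine, ha.faceArr_spine, (ha.deg _).faceArr_spine,
      (ha.face _).degArr_spine, pullback_pullback, pullback_pullback, key]

end LocalGroupoid
end

section
/- Let (M, U, V, s, t, e, m, i) be a local groupoid in sets and NG its nerve simplicial set. Then for every n ≥ 3 and every 0 ≤ j ≤ n, precomposition with the horn inclusion Λ[n,j] ⟶ Δ[n] induces a bijection from the set of simplicial maps Δ[n] ⟶ NG (equivalently, from NG_n) to the set of simplicial maps Λ[n,j] ⟶ NG. In other words, the nerve of a local groupoid satisfies the strict Kan conditions Kan!(n,j) in all dimensions n ≥ 3. -/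
namespace LocalGroupoid

variable (G : LocalGroupoid)

/-- The edge of the simplex `(x, g)` from the vertex `a` to the vertex `b`, meaningful for
`a < b`. -/
def edge (G : LocalGroupoid) {n : ℕ} (x : Fin (n + 1) → G.M) (g : Fin n → G.U)
    (a b : Fin (n + 1)) : G.U :=
  if h : (a : ℕ) < b then G.chain g a (b - a - 1) (by omega) else G.e (x a)

section Edge

variable {G : LocalGroupoid} {n : ℕ} {x : Fin (n + 1) → G.M} {g : Fin n → G.U}

theorem edge_eq_chain (x : Fin (n + 1) → G.M) (g : Fin n → G.U) (i k : ℕ) (h : i + k < n) :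
    G.edge x g ⟨i, by omega⟩ ⟨i + k + 1, by omega⟩ = G.chain g i k h := by
  have h1 : i < i + k + 1 := by omega
  have h2 : i + k + 1 - i - 1 = k := by omega
  simp only [edge, h1, dite_true, h2]

theorem exists_eq_add_of_lt {a b : Fin (n + 1)} (hab : a < b) :
    ∃ (i k : ℕ) (_ : i + k < n) (hi : i < n + 1) (hk : i + k + 1 < n + 1),
      a = ⟨i, hi⟩ ∧ b = ⟨i + k + 1, hk⟩ := by
  have := Fin.lt_def.1 hab
  exact ⟨a, b - a - 1, by omega, by omega, by omega, rfl, Fin.ext (by simp; omega)⟩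

theorem edge_castSucc_succ (x : Fin (n + 1) → G.M) (g : Fin n → G.U) (l : Fin n) :
    G.edge x g l.castSucc l.succ = g l :=
  edge_eq_chain x g l 0 (by omega)

theorem edge_eq_of_mul (x : Fin (n + 1) → G.M) {F : Fin (n + 1) → Fin (n + 1) → G.U}
    (hg : ∀ l : Fin n, g l = F l.castSucc l.succ)
    (hF : ∀ a b c, a < b → b < c → G.mul (F a b) (F b c) = F a c)
    {a b : Fin (n + 1)} (hab : a < b) : G.edge x g a b = F a b := by
  obtain ⟨i, k, h, _, _, rfl, rfl⟩ := exists_eq_add_of_lt hab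
  rw [edge_eq_chain x g i k h]
  clear hab
  induction k with
  | zero => exact hg ⟨i, by omega⟩
  | succ k ih =>
    rw [chain, ih (by omega), hg]
    exact hF _ _ _ (by simp [Fin.lt_def]) (by simp [Fin.lt_def])

theorem IsNerve.source_target_chain (hN : G.IsNerve x g) (i k : ℕ) (h : i + k < n) :
    G.t (G.chain g i k h) = x ⟨i, by omega⟩ ∧
      G.s (G.chain g i k h) = x ⟨i + k + 1, by omega⟩ := by
  induction k with
  | zero => exact hN.2.1 ⟨i, by omega⟩
  | succ k ih =>
    have h1 := ih (by omega)
    have h2 := hN.2.1 ⟨i + k + 1, h⟩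
    have hc := h1.2.trans h2.1.symm
    have hV := hN.2.2 i k (by omega)
    exact ⟨(G.t_mul _ _ hV (hN.1 _) hc).trans h1.1, (G.s_mul _ _ hV (hN.1 _) hc).trans h2.2⟩

theorem IsNerve.mul_chain (hN : G.IsNerve x g) (i k l : ℕ) (h : i + (k + l + 1) < n) :
    G.mul (G.chain g i k (by omega)) (G.chain g (i + k + 1) l (by omega)) =
      G.chain g i (k + l + 1) h := by
  induction l with
  | zero => rfl
  | succ l ih =>
    have ih := ih (by omega)
    have h1 := hN.source_target_chain i k (by omega)
    have h2 := hN.source_target_chain (i + k + 1) l (by omega)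
    have h3 := hN.2.1 ⟨i + k + 1 + l + 1, by omega⟩
    have hV := hN.2.2 (i + k + 1) (l + 1) (by omega)
    rw [chain] at hV ⊢
    rw [← G.mul_assoc _ _ _ (hN.2.2 i k (by omega)) (hN.2.2 _ _ _) (hN.1 _)
      (h1.2.trans h2.1.symm) (h2.2.trans h3.1.symm) (ih ▸ hN.2.2 _ _ _) hV, ih]
    change _ = G.mul _ (g ⟨i + (k + l + 1) + 1, by omega⟩)
    exact congrArg _ (congrArg g (Fin.ext (by simp; omega)))

theorem IsNerve.edge_mem (hN : G.IsNerve x g) {a b : Fin (n + 1)} (hab : a < b) :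
    G.edge x g a b ∈ G.V := by
  obtain ⟨i, k, h, _, _, rfl, rfl⟩ := exists_eq_add_of_lt hab
  rw [edge_eq_chain]
  exact hN.2.2 i k h

theorem IsNerve.source_target_edge (hN : G.IsNerve x g) {a b : Fin (n + 1)} (hab : a < b) :
    G.t (G.edge x g a b) = x a ∧ G.s (G.edge x g a b) = x b := by
  obtain ⟨i, k, h, _, _, rfl, rfl⟩ := exists_eq_add_of_lt hab
  rw [edge_eq_chain]
  exact hN.source_target_chain i k h

theorem IsNerve.mul_edge (hN : G.IsNerve x g) {a b c : Fin (n + 1)} (hab : a < b)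
    (hbc : b < c) : G.mul (G.edge x g a b) (G.edge x g b c) = G.edge x g a c := by
  rw [Fin.lt_def] at hab hbc
  have hac := hab.trans hbc
  have hb : (a : ℕ) + (b - a - 1) + 1 = b := by omega
  have hc : (b : ℕ) - a - 1 + (c - b - 1) + 1 = c - a - 1 := by omega
  have := hN.mul_chain a (b - a - 1) (c - b - 1) (by omega)
  simp only [hb, hc] at this
  simp only [edge, hab, hbc, hac, dite_true, this]

theorem isNerve_of_mul {F : Fin (n + 1) → Fin (n + 1) → G.U}
    (hg : ∀ l : Fin n, g l = F l.castSucc l.succ)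
    (hF : ∀ a b c, a < b → b < c → G.mul (F a b) (F b c) = F a c)
    (hV : ∀ a b, a < b → F a b ∈ G.V)
    (hx : ∀ a b, a < b → G.t (F a b) = x a ∧ G.s (F a b) = x b) : G.IsNerve x g := by
  refine ⟨fun l ↦ hg l ▸ hV _ _ l.castSucc_lt_succ, fun l ↦ hg l ▸ hx _ _ l.castSucc_lt_succ,
    fun i k h ↦ ?_⟩
  have hlt : (⟨i, by omega⟩ : Fin (n + 1)) < ⟨i + k + 1, by omega⟩ := by
    simp [Fin.lt_def]
  rw [← edge_eq_chain x g i k h, edge_eq_of_mul x hg hF hlt]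
  exact hV _ _ hlt

end Edge

theorem faceArr_eq_edge (G : LocalGroupoid) {n : ℕ} (x : Fin (n + 2) → G.M)
    (g : Fin (n + 1) → G.U) (i : Fin (n + 2)) (l : Fin n) :
    G.faceArr i g l = G.edge x g (i.succAbove l.castSucc) (i.succAbove l.succ) := by
  rw [faceArr]
  split_ifs with h1 h2
  · rw [← edge_castSucc_succ x g]
    congr 1 <;> ext <;> simp only [Fin.succAbove, Fin.lt_def] <;> split_ifs <;>
      (simp_all; try omega)
  · have := edge_eq_chain x g l 1 (by omega)
    rw [chain, chain] at this
    refine Eq.trans this.symm ?_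
    congr 1 <;> ext <;> simp only [Fin.succAbove, Fin.lt_def] <;> split_ifs <;>
      (simp_all; try omega)
  · rw [← edge_castSucc_succ x g]
    congr 1 <;> ext <;> simp only [Fin.succAbove, Fin.lt_def] <;> split_ifs <;>
      (simp_all; try omega)

theorem IsNerve.edge_face {G : LocalGroupoid} {n : ℕ} {x : Fin (n + 2) → G.M}
    {g : Fin (n + 1) → G.U} (hN : G.IsNerve x g) (i : Fin (n + 2)) {a b : Fin (n + 1)}
    (hab : a < b) :
    G.edge (faceVert i x) (G.faceArr i g) a b =
      G.edge x g (i.succAbove a) (i.succAbove b) :=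
  edge_eq_of_mul (F := fun a b ↦ G.edge x g (i.succAbove a) (i.succAbove b)) _
    (G.faceArr_eq_edge x g i)
    (fun _ _ _ h h' ↦ hN.mul_edge (Fin.strictMono_succAbove i h) (Fin.strictMono_succAbove i h'))
    hab

section Cancel

variable {G : LocalGroupoid} {g h k : G.U}

theorem inv_mul_cancel_left' (hg : g ∈ G.V) (hh : h ∈ G.V) (hgh : G.s g = G.t h)
    (hV : G.mul g h ∈ G.V) : G.mul (G.inv g) (G.mul g h) = h := by
  rw [← G.mul_assoc _ _ _ (G.inv_mem g hg) hg hh (G.s_inv g hg) hgh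
    (G.inv_mul g hg ▸ G.e_mem _) hV, G.inv_mul g hg, hgh, G.one_mul h hh]

theorem mul_inv_cancel_right' (hg : g ∈ G.V) (hh : h ∈ G.V) (hgh : G.s g = G.t h)
    (hV : G.mul g h ∈ G.V) : G.mul (G.mul g h) (G.inv h) = g := by
  rw [G.mul_assoc _ _ _ hg hh (G.inv_mem h hh) hgh (G.t_inv h hh).symm hV
    (G.mul_inv h hh ▸ G.e_mem _), G.mul_inv h hh, ← hgh, G.mul_one g hg]

end Cancel

/-- If all edges of a tetrahedron lie in `V` and the triangles through one vertex `j` commute,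
then so does the triangle opposite to `j`. -/
theorem mul_eq_of_opposite {G : LocalGroupoid} {n : ℕ} {x : Fin n → G.M}
    {F : Fin n → Fin n → G.U} (hV : ∀ a b, a < b → F a b ∈ G.V)
    (hx : ∀ a b, a < b → G.t (F a b) = x a ∧ G.s (F a b) = x b) {j : Fin n}
    (hF : ∀ a b c, a < b → b < c → a = j ∨ b = j ∨ c = j → G.mul (F a b) (F b c) = F a c)
    (a b c : Fin n) (hab : a < b) (hbc : b < c) : G.mul (F a b) (F b c) = F a c := by
  have hs : ∀ a b c, a < b → b < c → G.s (F a b) = G.t (F b c) := fun a b c h h' ↦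
    (hx a b h).2.trans (hx b c h').1.symm
  have hac := hab.trans hbc
  by_cases hj : a = j ∨ b = j ∨ c = j
  · exact hF a b c hab hbc hj
  simp only [not_or] at hj
  obtain ⟨haj, hbj, hcj⟩ := hj
  rcases lt_or_gt_of_ne haj with haj | haj
  · rcases lt_or_gt_of_ne hbj with hbj | hbj
    · rcases lt_or_gt_of_ne hcj with hcj | hcj
      · have h1 := hF a b j hab hbj (by simp)
        have h2 := hF b c j hbc hcj (by simp)
        have h3 := hF a c j hac hcj (by simp)
        have e1 := mul_inv_cancel_right' (hV a c hac) (hV c j hcj) (hs a c j hac hcj)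
          (h3 ▸ hV a j haj)
        have e2 := mul_inv_cancel_right' (hV b c hbc) (hV c j hcj) (hs b c j hbc hcj)
          (h2 ▸ hV b j hbj)
        rw [h3, ← h1] at e1
        rw [h2] at e2
        rw [← e1, G.mul_assoc _ _ _ (hV a b hab) (hV b j hbj) (G.inv_mem _ (hV c j hcj))
          (hs a b j hab hbj)
          ((hx b j hbj).2.trans ((G.t_inv _ (hV c j hcj)).trans (hx c j hcj).2).symm)
          (h1 ▸ hV a j haj) (e2 ▸ hV b c hbc), e2]
      · have h1 := hF a b j hab hbj (by simp)
        have h2 := hF b j c hbj hcj (by simp)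
        have h3 := hF a j c haj hcj (by simp)
        rw [← h2, ← h3, ← h1, G.mul_assoc _ _ _ (hV a b hab) (hV b j hbj) (hV j c hcj)
          (hs a b j hab hbj) (hs b j c hbj hcj) (h1 ▸ hV a j haj) (h2 ▸ hV b c hbc)]
    · have hcj := hbj.trans hbc
      have h1 := hF a j b haj hbj (by simp)
      have h2 := hF j b c hbj hbc (by simp)
      have h3 := hF a j c haj hcj (by simp)
      rw [← h1, ← h3, ← h2, G.mul_assoc _ _ _ (hV a j haj) (hV j b hbj) (hV b c hbc)
        (hs a j b haj hbj) (hs j b c hbj hbc) (h1 ▸ hV a b hab) (h2 ▸ hV j c hcj)]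
  · have hbj := haj.trans hab
    have hcj := hbj.trans hbc
    have h1 := hF j a b haj hab (by simp)
    have h2 := hF j b c hbj hbc (by simp)
    have h3 := hF j a c haj hac (by simp)
    have e1 := inv_mul_cancel_left' (hV j a haj) (hV a c hac) (hs j a c haj hac)
      (h3 ▸ hV j c hcj)
    have e2 := inv_mul_cancel_left' (hV j a haj) (hV a b hab) (hs j a b haj hab)
      (h1 ▸ hV j b hbj)
    rw [h3, ← h2] at e1
    rw [h1] at e2
    rw [← e1, ← G.mul_assoc _ _ _ (G.inv_mem _ (hV j a haj)) (hV j b hbj) (hV b c hbc)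
      (((G.s_inv _ (hV j a haj)).trans (hx j a haj).1).trans (hx j b hbj).1.symm)
      (hs j b c hbj hbc) (e2 ▸ hV a b hab) (h2 ▸ hV j c hcj), e2]

theorem exists_ne_ne_ne {n : ℕ} (a b c : Fin (n + 4)) : ∃ i, i ≠ a ∧ i ≠ b ∧ i ≠ c := by
  by_contra! h
  have h0 := h ⟨0, by omega⟩
  have h1 := h ⟨1, by omega⟩
  have h2 := h ⟨2, by omega⟩
  have h3 := h ⟨3, by omega⟩
  simp only [ne_eq, Fin.ext_iff] at h0 h1 h2 h3
  omega

/-- If the faces opposite to `i < k` share a vertex, it lies in their common face. -/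
theorem exists_of_succAbove_eq {n : ℕ} {i k : Fin (n + 2)} (hik : i < k) {a b : Fin (n + 1)}
    (h : i.succAbove a = k.succAbove b) :
    ∃ (hi : (i : ℕ) < n + 1) (hk : (k : ℕ) - 1 < n + 1) (c : Fin n),
      a = (⟨k - 1, hk⟩ : Fin (n + 1)).succAbove c ∧
        b = (⟨i, hi⟩ : Fin (n + 1)).succAbove c := by
  have hik' := Fin.lt_def.1 hik
  have hi : (i : ℕ) < n + 1 := by omega
  have hb : b ≠ ⟨i, hi⟩ := by
    rintro rfl
    refine Fin.succAbove_ne i a (h.trans ?_)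
    ext
    simp only [Fin.succAbove, Fin.lt_def, Fin.val_castSucc]
    split_ifs <;> simp_all
  obtain ⟨c, rfl⟩ := Fin.exists_succAbove_eq hb
  refine ⟨hi, by omega, c, Fin.succAbove_right_injective (p := i) (h.trans ?_), rfl⟩
  ext
  simp only [Fin.succAbove, Fin.lt_def, Fin.val_castSucc]
  split_ifs <;> simp_all <;> omega

/-- The nerve of a local groupoid satisfies the strict Kan conditions `Kan!(N, j)` in all
dimensions `N = n + 3 ≥ 3`: giving a simplicial map `Λ[N, j] ⟶ NG` is the same as giving a
compatible family of `(N-1)`-simplices `y_i` (`i ≠ j`) with `d_i (y_k) = d_{k-1} (y_i)` for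
`i < k`, `i, k ≠ j`, and every such horn extends uniquely to an `N`-simplex `z` of the nerve
(with `d_i z = y_i` for all `i ≠ j`); hence `Hom(Δ[N], NG) → Hom(Λ[N, j], NG)` is a
bijection. -/
theorem nerve_strict_kan_of_dim_ge_three (G : LocalGroupoid) (n : ℕ) (j : Fin (n + 4))
    (yx : Fin (n + 4) → Fin (n + 3) → G.M) (yg : Fin (n + 4) → Fin (n + 2) → G.U)
    (hy : ∀ i : Fin (n + 4), i ≠ j → G.IsNerve (yx i) (yg i))
    (hcomp : ∀ (i k : ℕ) (hik : i < k) (hk : k ≤ n + 3),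
      (⟨i, by omega⟩ : Fin (n + 4)) ≠ j → (⟨k, by omega⟩ : Fin (n + 4)) ≠ j →
      faceVert (⟨i, by omega⟩ : Fin (n + 3)) (yx ⟨k, by omega⟩) =
        faceVert (⟨k - 1, by omega⟩ : Fin (n + 3)) (yx ⟨i, by omega⟩) ∧
      G.faceArr (⟨i, by omega⟩ : Fin (n + 3)) (yg ⟨k, by omega⟩) =
        G.faceArr (⟨k - 1, by omega⟩ : Fin (n + 3)) (yg ⟨i, by omega⟩)) :
    ∃! z : (Fin (n + 4) → G.M) × (Fin (n + 3) → G.U),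
      G.IsNerve z.1 z.2 ∧
      ∀ i : Fin (n + 4), i ≠ j → faceVert i z.1 = yx i ∧ G.faceArr i z.2 = yg i := by
  have hvert : ∀ i k a b, i ≠ j → k ≠ j → i.succAbove a = k.succAbove b →
      yx i a = yx k b := by
    intro i k a b hi hk h
    wlog hik : i ≤ k generalizing i k a b
    · exact (this k i b a hk hi h.symm (le_of_not_ge hik)).symm
    rcases hik.eq_or_lt with rfl | hik
    · rw [Fin.succAbove_right_injective h]
    obtain ⟨_, _, c, rfl, rfl⟩ := exists_of_succAbove_eq hik h
    exact (congrFun (hcomp i k hik (by omega) hi hk).1 c).symm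
  have hedge : ∀ i k a b a' b', i ≠ j → k ≠ j → a < b → i.succAbove a = k.succAbove a' →
      i.succAbove b = k.succAbove b' →
      G.edge (yx i) (yg i) a b = G.edge (yx k) (yg k) a' b' := by
    intro i k a b a' b' hi hk hab ha hb
    wlog hik : i ≤ k generalizing i k a b a' b'
    · refine (this k i a' b' a b hk hi ?_ ha.symm hb.symm (le_of_not_ge hik)).symm
      rwa [← (Fin.strictMono_succAbove k).lt_iff_lt, ← ha, ← hb,
        (Fin.strictMono_succAbove i).lt_iff_lt]
    rcases hik.eq_or_lt with rfl | hik
    · rw [Fin.succAbove_right_injective ha, Fin.succAbove_right_injective hb]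
    obtain ⟨_, _, c, rfl, rfl⟩ := exists_of_succAbove_eq hik ha
    obtain ⟨_, _, d, rfl, rfl⟩ := exists_of_succAbove_eq hik hb
    rw [(Fin.strictMono_succAbove _).lt_iff_lt] at hab
    have hc := hcomp i k hik (by omega) hi hk
    rw [← (hy i hi).edge_face _ hab, ← (hy k hk).edge_face _ hab]
    exact congrArg₂ (fun x g ↦ G.edge x g c d) hc.1.symm hc.2.symm
  obtain ⟨X, hX⟩ : ∃ X : Fin (n + 4) → G.M, ∀ i a, i ≠ j → X (i.succAbove a) = yx i a := by
    have : Nonempty G.M := ⟨yx 0 0⟩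
    obtain ⟨X, hX⟩ := (Function.factorsThrough_iff
      (f := fun p : {p : Fin (n + 4) × Fin (n + 3) // p.1 ≠ j} ↦ p.1.1.succAbove p.1.2)
      (fun p ↦ yx p.1.1 p.1.2)).1 fun p q h ↦ hvert _ _ _ _ p.2 q.2 h
    exact ⟨X, fun i a hi ↦ (congrFun hX ⟨(i, a), hi⟩).symm⟩
  obtain ⟨E, hE⟩ : ∃ E : Fin (n + 4) → Fin (n + 4) → G.U, ∀ i a b, i ≠ j → a < b →
      E (i.succAbove a) (i.succAbove b) = G.edge (yx i) (yg i) a b := by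
    have : Nonempty G.U := ⟨yg 0 0⟩
    obtain ⟨E, hE⟩ := (Function.factorsThrough_iff
      (f := fun p : {p : Fin (n + 4) × Fin (n + 3) × Fin (n + 3) // p.1 ≠ j ∧ p.2.1 < p.2.2} ↦
        (p.1.1.succAbove p.1.2.1, p.1.1.succAbove p.1.2.2))
      (fun p ↦ G.edge (yx p.1.1) (yg p.1.1) p.1.2.1 p.1.2.2)).1 fun p q h ↦
        hedge _ _ _ _ _ _ p.2.1 q.2.1 p.2.2 (congrArg Prod.fst h) (congrArg Prod.snd h)
    exact ⟨fun a b ↦ E (a, b), fun i a b hi hab ↦ (congrFun hE ⟨(i, a, b), hi, hab⟩).symm⟩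
  have hV : ∀ a b, a < b → E a b ∈ G.V := by
    intro a b hab
    obtain ⟨i, hia, hib, hij⟩ := exists_ne_ne_ne a b j
    obtain ⟨a, rfl⟩ := Fin.exists_succAbove_eq hia.symm
    obtain ⟨b, rfl⟩ := Fin.exists_succAbove_eq hib.symm
    rw [(Fin.strictMono_succAbove i).lt_iff_lt] at hab
    exact hE i a b hij hab ▸ (hy i hij).edge_mem hab
  have hst : ∀ a b, a < b → G.t (E a b) = X a ∧ G.s (E a b) = X b := by
    intro a b hab
    obtain ⟨i, hia, hib, hij⟩ := exists_ne_ne_ne a b j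
    obtain ⟨a, rfl⟩ := Fin.exists_succAbove_eq hia.symm
    obtain ⟨b, rfl⟩ := Fin.exists_succAbove_eq hib.symm
    rw [(Fin.strictMono_succAbove i).lt_iff_lt] at hab
    rw [hE i a b hij hab, hX i a hij, hX i b hij]
    exact (hy i hij).source_target_edge hab
  have hmul : ∀ a b c, a < b → b < c → G.mul (E a b) (E b c) = E a c := by
    refine mul_eq_of_opposite hV hst (j := j) fun a b c hab hbc habc ↦ ?_
    obtain ⟨i, hia, hib, hic⟩ := exists_ne_ne_ne a b c
    have hij : i ≠ j := by rcases habc with rfl | rfl | rfl <;> assumption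
    obtain ⟨a, rfl⟩ := Fin.exists_succAbove_eq hia.symm
    obtain ⟨b, rfl⟩ := Fin.exists_succAbove_eq hib.symm
    obtain ⟨c, rfl⟩ := Fin.exists_succAbove_eq hic.symm
    rw [(Fin.strictMono_succAbove i).lt_iff_lt] at hab hbc
    rw [hE i a b hij hab, hE i b c hij hbc, hE i a c hij (hab.trans hbc)]
    exact (hy i hij).mul_edge hab hbc
  refine ⟨(X, fun l ↦ E l.castSucc l.succ),
    ⟨isNerve_of_mul (fun _ ↦ rfl) hmul hV hst, fun i hi ↦ ⟨funext fun a ↦ hX i a hi,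
      funext fun l ↦ ?_⟩⟩, ?_⟩
  · have hl : i.succAbove l.castSucc < i.succAbove l.succ :=
      Fin.strictMono_succAbove i l.castSucc_lt_succ
    rw [G.faceArr_eq_edge X, edge_eq_of_mul X (fun _ ↦ rfl) hmul hl,
      hE i _ _ hi l.castSucc_lt_succ, edge_castSucc_succ]
  · rintro ⟨x, g⟩ ⟨hN, hface⟩
    refine Prod.ext (funext fun a ↦ ?_) (funext fun l ↦ ?_)
    · obtain ⟨i, hia, -, hij⟩ := exists_ne_ne_ne a a j
      obtain ⟨a, rfl⟩ := Fin.exists_succAbove_eq hia.symm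
      exact (congrFun (hface i hij).1 a).trans (hX i a hij).symm
    · obtain ⟨i, hia, hib, hij⟩ := exists_ne_ne_ne l.castSucc l.succ j
      obtain ⟨a, ha⟩ := Fin.exists_succAbove_eq hia.symm
      obtain ⟨b, hb⟩ := Fin.exists_succAbove_eq hib.symm
      have hab : a < b := by
        rw [← (Fin.strictMono_succAbove i).lt_iff_lt, ha, hb]
        exact l.castSucc_lt_succ
      change g l = E l.castSucc l.succ
      rw [← edge_castSucc_succ x g l, ← ha, ← hb, hE i a b hij hab, ← hN.edge_face i hab]
      exact congrArg₂ (fun x g ↦ G.edge x g a b) (hface i hij).1 (hface i hij).2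

end LocalGroupoid
end
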